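/- Let n ≥ 2, k ≥ 1, α ∈ (1/2, 1], γ = n^{α−1}, d ∈ (0, 1], and 0 < τ ≤ d·n^{α/2}/4. Let A be a (deterministic) symmetric n×n matrix with entries in [0,1], zero diagonal, and degree matrix D (diagonal, D_{ii} = Σ_j A_{ij}) with D_{ii} ≥ n·d for all i, and set P = D^{−1}A. Let Â be a random symmetric n×n matrix whose entries Â_{ij} = Â_{ji} for i < j are independent Bernoulli random variables with success probabilities γ·A_{ij}, with Â_{ii} = 0 and degree matrix D̂. Then with probability at least 1 − 4·n²·e^{−τ²/(1+τ)}: D̂ is invertible and, with P̂ = D̂^{−1}Â, max_{i,j} n·|[P^k·(P − P̂)]_{ij}| ≤ 4·n^{−α/2}·d^{−2}·τ. -/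

import Mathlib

open MeasureTheory

/-- Bernoulli measure on `Bool` with success probability `p`. -/
noncomputable def bern (p : ℝ) : Measure Bool :=
  ENNReal.ofReal (1 - p) • Measure.dirac false + ENNReal.ofReal p • Measure.dirac true

/-- The law of the independent edge indicators of the subsampled graph: each edge
`{i, j}` with `i < j` is present independently with probability `γ · A i j`. -/
noncomputable def edgeMeasure {n : ℕ} (A : Matrix (Fin n) (Fin n) ℝ) (γ : ℝ) :
    Measure ({q : Fin n × Fin n // q.1 < q.2} → Bool) :=
  Measure.pi fun q => bern (γ * A q.1.1 q.1.2)

/-- The (symmetric, zero-diagonal) adjacency matrix built from the edge indicators. -/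
noncomputable def hatA {n : ℕ} (e : {q : Fin n × Fin n // q.1 < q.2} → Bool) :
    Matrix (Fin n) (Fin n) ℝ :=
  Matrix.of fun i j =>
    if h : i < j then (if e ⟨(i, j), h⟩ then 1 else 0)
    else if h' : j < i then (if e ⟨(j, i), h'⟩ then 1 else 0)
    else 0

open ProbabilityTheory

theorem isProbabilityMeasure_bern {p : ℝ} (hp : p ∈ Set.Icc (0 : ℝ) 1) :
    IsProbabilityMeasure (bern p) := by
  constructor
  simp only [bern, Measure.coe_add, Measure.coe_smul, Pi.add_apply, Pi.smul_apply, smul_eq_mul,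
    measure_univ, mul_one]
  rw [← ENNReal.ofReal_add (by linarith [hp.2]) hp.1]
  simp

theorem integral_bern {p : ℝ} (hp : p ∈ Set.Icc (0 : ℝ) 1) (f : Bool → ℝ) :
    ∫ b, f b ∂bern p = (1 - p) * f false + p * f true := by
  rw [bern, integral_add_measure (Integrable.smul_measure .of_finite ENNReal.ofReal_ne_top)
      (Integrable.smul_measure .of_finite ENNReal.ofReal_ne_top),
    integral_smul_measure, integral_smul_measure, integral_dirac, integral_dirac,
    ENNReal.toReal_ofReal (by linarith [hp.2]), ENNReal.toReal_ofReal hp.1]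
  simp

/-- The moment generating function of a centred and scaled Bernoulli variable is dominated
by a Gaussian one near zero. -/
theorem bernoulli_mgf_le {p x : ℝ} (hp : p ∈ Set.Icc (0 : ℝ) 1) (hx : |x| ≤ 1) :
    (1 - p) * Real.exp (x * (0 - p)) + p * Real.exp (x * (1 - p)) ≤ Real.exp (p * x ^ 2) := by
  have h1 : Real.exp (x * (1 - p)) = Real.exp (x * (0 - p)) * Real.exp x := by
    rw [← Real.exp_add]; ring_nf
  have h2 : 1 + p * (Real.exp x - 1) ≤ Real.exp (p * (Real.exp x - 1)) := by
    linarith [Real.add_one_le_exp (p * (Real.exp x - 1))]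
  have h3 : Real.exp x - 1 - x ≤ x ^ 2 :=
    (le_abs_self _).trans (Real.abs_exp_sub_one_sub_id_le hx)
  calc (1 - p) * Real.exp (x * (0 - p)) + p * Real.exp (x * (1 - p))
      = Real.exp (x * (0 - p)) * (1 + p * (Real.exp x - 1)) := by rw [h1]; ring
    _ ≤ Real.exp (x * (0 - p)) * Real.exp (p * (Real.exp x - 1)) := by gcongr
    _ = Real.exp (p * (Real.exp x - 1 - x)) := by rw [← Real.exp_add]; ring_nf
    _ ≤ Real.exp (p * x ^ 2) := by
        have := hp.1
        gcongr

/-- Two-sided Chernoff bound for independent variables with a quadratic bound on the cumulant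
generating function on `[-1, 1]`. -/
theorem measureReal_abs_sum_ge_le {Ω ι : Type*} [MeasurableSpace Ω] [Fintype ι] {μ : Measure Ω}
    [IsProbabilityMeasure μ] {X : ι → Ω → ℝ} (hX : iIndepFun X μ) (hm : ∀ i, Measurable (X i))
    (hint : ∀ t, Integrable (fun ω => Real.exp (t * ∑ i, X i ω)) μ)
    {v : ι → ℝ} {V : ℝ} (hv : ∑ i, v i ≤ V)
    (hmgf : ∀ i t, |t| ≤ 1 → mgf (X i) μ t ≤ Real.exp (v i * t ^ 2))
    {s ε : ℝ} (hs0 : 0 ≤ s) (hs1 : s ≤ 1) :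
    μ.real {ω | ε ≤ |∑ i, X i ω|} ≤ 2 * Real.exp (V * s ^ 2 - s * ε) := by
  have hsum : (∑ i, X i) = fun ω => ∑ i, X i ω := by ext; simp
  have key : ∀ t, |t| = s → mgf (fun ω => ∑ i, X i ω) μ t ≤ Real.exp (V * s ^ 2) := by
    intro t ht
    rw [← hsum, hX.mgf_sum hm]
    calc ∏ i, mgf (X i) μ t ≤ ∏ i, Real.exp (v i * t ^ 2) :=
          Finset.prod_le_prod (fun i _ => mgf_nonneg) fun i _ => hmgf i t (ht.trans_le hs1)
      _ = Real.exp ((∑ i, v i) * t ^ 2) := by rw [← Real.exp_sum, Finset.sum_mul]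
      _ ≤ Real.exp (V * s ^ 2) := by rw [← ht, sq_abs]; gcongr
  have hup := measure_ge_le_exp_mul_mgf (μ := μ) ε hs0 (hint s)
  have hlo := measure_le_le_exp_mul_mgf (μ := μ) (-ε) (neg_nonpos.2 hs0) (hint (-s))
  have hsub : {ω | ε ≤ |∑ i, X i ω|} ⊆ {ω | ε ≤ ∑ i, X i ω} ∪ {ω | ∑ i, X i ω ≤ -ε} := by
    intro ω hω
    rcases le_abs.1 (show ε ≤ |∑ i, X i ω| from hω) with h | h
    · exact Or.inl h
    · exact Or.inr (by simp only [Set.mem_ofPred_eq]; linarith)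
  have hE : Real.exp (V * s ^ 2 - s * ε) = Real.exp (-s * ε) * Real.exp (V * s ^ 2) := by
    rw [← Real.exp_add]; ring_nf
  have h1 := mul_le_mul_of_nonneg_left (key s (abs_of_nonneg hs0)) (Real.exp_pos (-s * ε)).le
  have h2 := mul_le_mul_of_nonneg_left (key (-s) (by rw [abs_neg, abs_of_nonneg hs0]))
    (Real.exp_pos (-s * ε)).le
  have h3 := (measureReal_mono (μ := μ) hsub).trans (measureReal_union_le _ _)
  rw [show - -s * -ε = -s * ε by ring] at hlo
  linarith

theorem isProbabilityMeasure_edgeMeasure {n : ℕ} {A : Matrix (Fin n) (Fin n) ℝ} {γ : ℝ}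
    (hp : ∀ i j, γ * A i j ∈ Set.Icc (0 : ℝ) 1) : IsProbabilityMeasure (edgeMeasure A γ) := by
  have := fun q : {q : Fin n × Fin n // q.1 < q.2} =>
    isProbabilityMeasure_bern (hp q.1.1 q.1.2)
  unfold edgeMeasure
  infer_instance

/-- The edge `{l, j}` in increasing order. -/
def orderedEdge {n : ℕ} (j : Fin n) (l : {l : Fin n // l ≠ j}) :
    {q : Fin n × Fin n // q.1 < q.2} :=
  if h : l.1 < j then ⟨(l.1, j), h⟩ else ⟨(j, l.1), lt_of_le_of_ne (not_lt.1 h) l.2.symm⟩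

theorem orderedEdge_injective {n : ℕ} (j : Fin n) : Function.Injective (orderedEdge j) := by
  rintro ⟨l, hl⟩ ⟨m, hm⟩ h
  unfold orderedEdge at h
  split_ifs at h <;> simp_all

theorem hatA_eq_orderedEdge {n : ℕ} (e : {q : Fin n × Fin n // q.1 < q.2} → Bool) (j : Fin n)
    (l : {l : Fin n // l ≠ j}) :
    hatA e l j = if e (orderedEdge j l) then 1 else 0 := by
  obtain ⟨l, hl⟩ := l
  rcases lt_or_gt_of_ne hl with h | h
  · simp [hatA, orderedEdge, h]
  · simp [hatA, orderedEdge, h, h.not_gt]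

theorem hatA_self {n : ℕ} (e : {q : Fin n × Fin n // q.1 < q.2} → Bool) (j : Fin n) :
    hatA e j j = 0 := by
  simp [hatA]

theorem hatA_comm {n : ℕ} (e : {q : Fin n × Fin n // q.1 < q.2} → Bool) (i j : Fin n) :
    hatA e i j = hatA e j i := by
  rcases lt_trichotomy i j with h | rfl | h
  · simp [hatA, h, h.not_gt]
  · rfl
  · simp [hatA, h, h.not_gt]

theorem hatA_nonneg {n : ℕ} (e : {q : Fin n × Fin n // q.1 < q.2} → Bool) (i j : Fin n) :
    0 ≤ hatA e i j := by
  simp only [hatA, Matrix.of_apply]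
  split_ifs <;> norm_num

theorem apply_orderedEdge {n : ℕ} {A : Matrix (Fin n) (Fin n) ℝ} (hA : A.IsSymm) (j : Fin n)
    (l : {l : Fin n // l ≠ j}) :
    A (orderedEdge j l).1.1 (orderedEdge j l).1.2 = A l j := by
  unfold orderedEdge
  split_ifs
  · rfl
  · exact hA.apply _ _

/-- Concentration of a weighted column sum of the subsampled adjacency matrix. -/
theorem edgeMeasure_abs_weighted_column_ge_le {n : ℕ} {A : Matrix (Fin n) (Fin n) ℝ} {γ : ℝ}
    (hA : A.IsSymm) (hdiag : ∀ i, A i i = 0) (hp : ∀ i j, γ * A i j ∈ Set.Icc (0 : ℝ) 1)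
    (hpγ : ∀ i j, γ * A i j ≤ γ)
    {u : Fin n → ℝ} (hu : ∀ l, |u l| ≤ 1) (j : Fin n) {s ε : ℝ} (hs0 : 0 ≤ s) (hs1 : s ≤ 1) :
    (edgeMeasure A γ).real {e | ε ≤ |∑ l, u l * (hatA e l j - γ * A l j)|} ≤
      2 * Real.exp (γ * n * s ^ 2 - s * ε) := by
  have hprob := isProbabilityMeasure_edgeMeasure hp
  have hb := fun q : {q : Fin n × Fin n // q.1 < q.2} =>
    isProbabilityMeasure_bern (hp q.1.1 q.1.2)
  let f : {l : Fin n // l ≠ j} → Bool → ℝ := fun l b => u l * ((if b then 1 else 0) - γ * A l j)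
  let X : {l : Fin n // l ≠ j} → ({q : Fin n × Fin n // q.1 < q.2} → Bool) → ℝ :=
    fun l e => f l (e (orderedEdge j l))
  have hsum : ∀ e, ∑ l, u l * (hatA e l j - γ * A l j) = ∑ l, X l e := by
    intro e
    rw [Fintype.sum_eq_add_sum_subtype_ne _ j, hatA_self, hdiag]
    simp only [mul_zero, sub_zero, zero_add]
    exact Finset.sum_congr rfl fun l _ => by rw [hatA_eq_orderedEdge]
  have hm : ∀ l, Measurable (X l) := fun l =>
    (measurable_of_countable (f l)).comp (measurable_pi_apply _)
  have hind : iIndepFun X (edgeMeasure A γ) := by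
    have h0 : iIndepFun (fun q (e : {q : Fin n × Fin n // q.1 < q.2} → Bool) => e q)
        (edgeMeasure A γ) := iIndepFun_pi (X := fun _ b => b) (fun _ => aemeasurable_id)
    exact (h0.precomp (orderedEdge_injective j)).comp f fun l => measurable_of_countable (f l)
  simp only [hsum]
  refine measureReal_abs_sum_ge_le hind hm (fun t => ?_) (v := fun l => γ * A l j) ?_ ?_ hs0 hs1
  · exact .of_finite
  · calc ∑ l : {l : Fin n // l ≠ j}, γ * A l j ≤ ∑ l, γ * A l j := by
          rw [Fintype.sum_eq_add_sum_subtype_ne (fun l => γ * A l j) j, hdiag]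
          simp
      _ ≤ ∑ _l : Fin n, γ := Finset.sum_le_sum fun l _ => hpγ l j
      _ = γ * n := by simp [mul_comm]
  · intro l t ht
    have hlaw : (edgeMeasure A γ).map (fun e => e (orderedEdge j l)) = bern (γ * A l j) := by
      rw [← apply_orderedEdge hA]
      exact (measurePreserving_eval _ (orderedEdge j l)).map_eq
    have : mgf (X l) (edgeMeasure A γ) t = ∫ b, Real.exp (t * f l b) ∂bern (γ * A l j) := by
      rw [← hlaw, integral_map (measurable_pi_apply _).aemeasurable (by fun_prop)]
      rfl
    have hx : |t * u l| ≤ 1 := by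
      rw [abs_mul]
      exact mul_le_one₀ ht (abs_nonneg _) (hu l)
    have hsq : (t * u l) ^ 2 ≤ t ^ 2 := by
      rw [mul_pow]
      exact mul_le_of_le_one_right (sq_nonneg t) ((sq_le_one_iff_abs_le_one _).2 (hu l))
    rw [this, integral_bern (hp _ _)]
    simp only [f, Bool.false_eq_true, if_false, if_true, ← mul_assoc]
    exact (bernoulli_mgf_le (hp _ _) hx).trans
      (Real.exp_le_exp.2 (mul_le_mul_of_nonneg_left hsq (hp _ _).1))

/-- Deterministic comparison of two random walks, when all degrees and one weighted column sum are
within `τ * a` of their means, where `a ^ 2 = γ * N`. -/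
theorem abs_sum_transition_sub_le {ι : Type*} [Fintype ι] {A B : ι → ι → ℝ} {w : ι → ℝ}
    {N γ a d τ : ℝ} (hN : 0 < N) (ha : 0 < a) (hγ : 0 < γ) (haN : a ^ 2 = γ * N)
    (hd : 0 < d) (hτ0 : 0 < τ) (hτ : τ ≤ d * a / 4)
    (hD : ∀ i, N * d ≤ ∑ j, A i j) (hB : ∀ i j, 0 ≤ B i j) (hw : ∀ i, 0 ≤ w i) (j : ι)
    (hwA : ∑ l, w l * (A l j / ∑ m, A l m) ≤ 1 / (N * d))
    (hdeg : ∀ l, |∑ m, B l m - γ * ∑ m, A l m| ≤ τ * a)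
    (hcol : |∑ l, (N * d) ^ 2 * (w l / ∑ m, A l m) * (B l j - γ * A l j)| ≤ τ * a) :
    N * |∑ l, w l * (A l j / ∑ m, A l m - B l j / ∑ m, B l m)| ≤ 4 * a⁻¹ * (d ^ 2)⁻¹ * τ := by
  set D : ι → ℝ := fun l => ∑ m, A l m with hDdef
  set E : ι → ℝ := fun l => ∑ m, B l m with hEdef
  have hNd : 0 < N * d := by positivity
  have hDpos : ∀ l, 0 < D l := fun l => hNd.trans_le (hD l)
  have hElb : ∀ l, 3 / 4 * (d * a ^ 2) ≤ E l := by
    intro l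
    have h1 := (abs_le.1 (hdeg l)).1
    have h2 : γ * (N * d) ≤ γ * D l := mul_le_mul_of_nonneg_left (hD l) hγ.le
    have h3 : τ * a ≤ d * a / 4 * a := mul_le_mul_of_nonneg_right hτ ha.le
    have h4 : γ * (N * d) = d * a ^ 2 := by rw [haN]; ring
    change -(τ * a) ≤ E l - γ * D l at h1
    nlinarith
  have hElb_pos : 0 < 3 / 4 * (d * a ^ 2) := by positivity
  have hEpos : ∀ l, 0 < E l := fun l => hElb_pos.trans_le (hElb l)
  set S := ∑ l, w l / D l * (B l j - γ * A l j) with hS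
  have hSle : |S| ≤ τ * a / (N * d) ^ 2 := by
    have : ∑ l, (N * d) ^ 2 * (w l / D l) * (B l j - γ * A l j) = (N * d) ^ 2 * S := by
      rw [hS, Finset.mul_sum]
      exact Finset.sum_congr rfl fun l _ => by ring
    change |∑ l, (N * d) ^ 2 * (w l / D l) * (B l j - γ * A l j)| ≤ τ * a at hcol
    rw [this, abs_mul, abs_of_pos (by positivity)] at hcol
    rw [le_div_iff₀ (by positivity)]
    linarith
  have hT : ∑ l, w l * B l j / D l ≤ γ / (N * d) + τ * a / (N * d) ^ 2 := by
    have : ∑ l, w l * B l j / D l = γ * (∑ l, w l * (A l j / D l)) + S := by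
      rw [hS, Finset.mul_sum, ← Finset.sum_add_distrib]
      exact Finset.sum_congr rfl fun l _ => by ring
    rw [this]
    have h1 := mul_le_mul_of_nonneg_left hwA hγ.le
    have h2 := (le_abs_self S).trans hSle
    rw [mul_one_div] at h1
    exact add_le_add h1 h2
  set c := τ * a / (γ * (3 / 4 * (d * a ^ 2))) with hc
  have hsplit : ∑ l, w l * (A l j / D l - B l j / E l) =
      -(S / γ) + ∑ l, w l * B l j / D l * ((E l - γ * D l) / (γ * E l)) := by
    rw [hS, Finset.sum_div, ← Finset.sum_neg_distrib, ← Finset.sum_add_distrib]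
    refine Finset.sum_congr rfl fun l _ => ?_
    have := (hDpos l).ne'
    have := (hEpos l).ne'
    field_simp
    ring
  have hR : |∑ l, w l * B l j / D l * ((E l - γ * D l) / (γ * E l))| ≤
      (γ / (N * d) + τ * a / (N * d) ^ 2) * c := by
    refine (Finset.abs_sum_le_sum_abs _ _).trans ?_
    refine le_trans (Finset.sum_le_sum (g := fun l => w l * B l j / D l * c) fun l _ => ?_) ?_
    · have h0 : 0 ≤ w l * B l j / D l := div_nonneg (mul_nonneg (hw l) (hB l j)) (hDpos l).le
      rw [abs_mul, abs_of_nonneg h0, abs_div, abs_of_pos (mul_pos hγ (hEpos l)), hc]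
      refine mul_le_mul_of_nonneg_left ?_ h0
      exact div_le_div₀ (by positivity) (hdeg l) (by positivity)
        (mul_le_mul_of_nonneg_left (hElb l) hγ.le)
    · rw [← Finset.sum_mul]
      exact mul_le_mul_of_nonneg_right hT (by positivity)
  change N * |∑ l, w l * (A l j / D l - B l j / E l)| ≤ _
  rw [hsplit]
  have hγN : γ = a ^ 2 / N := by field_simp; linarith
  calc N * |-(S / γ) + ∑ l, w l * B l j / D l * ((E l - γ * D l) / (γ * E l))|
      ≤ N * (τ * a / (N * d) ^ 2 / γ + (γ / (N * d) + τ * a / (N * d) ^ 2) * c) := by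
        refine mul_le_mul_of_nonneg_left ((abs_add_le _ _).trans (add_le_add ?_ hR)) hN.le
        rw [abs_neg, abs_div, abs_of_pos hγ]
        gcongr
    _ = τ / (a * d ^ 2) * (1 + 4 / 3 * (1 + τ / (a * d))) := by
        rw [hc, hγN]
        field_simp
    _ ≤ τ / (a * d ^ 2) * 4 := by
        have : τ / (a * d) ≤ 1 / 4 := by
          rw [div_le_iff₀ (by positivity)]
          linarith
        gcongr
        linarith
    _ = 4 * a⁻¹ * (d ^ 2)⁻¹ * τ := by
        field_simp

theorem Matrix.mul_apply_le_of_mem_rowStochastic {ι : Type*} [Fintype ι] [DecidableEq ι]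
    {M Q : Matrix ι ι ℝ} {c : ℝ} (hM : M ∈ Matrix.rowStochastic ℝ ι) (hQ : ∀ i j, Q i j ≤ c)
    (i j : ι) : (M * Q) i j ≤ c := by
  rw [Matrix.mul_apply]
  calc ∑ l, M i l * Q l j ≤ ∑ l, M i l * c := Finset.sum_le_sum fun l _ =>
        mul_le_mul_of_nonneg_left (hQ l j) (Matrix.nonneg_of_mem_rowStochastic hM)
    _ = c := by rw [← Finset.sum_mul, Matrix.sum_row_of_mem_rowStochastic hM, one_mul]

theorem three_le_of_mul_exp_lt_one {n : ℕ} (hn : 2 ≤ n) {τ : ℝ} (hτ : 0 < τ)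
    (h : 4 * (n : ℝ) ^ 2 * Real.exp (-(τ ^ 2) / (1 + τ)) < 1) : 3 ≤ τ := by
  by_contra! hlt
  have hn' : (2 : ℝ) ≤ n := by exact_mod_cast hn
  have h1 : (-9 / 4 : ℝ) ≤ -(τ ^ 2) / (1 + τ) := by
    rw [le_div_iff₀ (by positivity)]
    nlinarith
  have h2 : (1 / 16 : ℝ) ≤ Real.exp (-9 / 4) := by
    have h3 : Real.exp (-9 / 4) * Real.exp (9 / 4) = 1 := by rw [← Real.exp_add]; norm_num
    have h4 : Real.exp (9 / 4) ≤ 16 := by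
      have h6 : Real.exp (9 / 4) = Real.exp 1 ^ 2 * Real.exp (1 / 4) := by
        rw [← Real.exp_nat_mul, ← Real.exp_add]; norm_num
      have h7 : Real.exp (1 / 4) ≤ 2 := by
        have := Real.abs_exp_sub_one_sub_id_le (x := 1 / 4) (by norm_num [abs_of_pos])
        have := (abs_le.1 this).2
        norm_num at this
        linarith
      have h8 := Real.exp_one_lt_d9
      have h9 := Real.exp_pos 1
      rw [h6]
      nlinarith [Real.exp_pos (1 / 4)]
    nlinarith [Real.exp_pos (-9 / 4)]
  have h3 := Real.exp_le_exp.2 h1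
  nlinarith

/-- Concentration of `P^k·(P − P̂)` under sparse edge subsampling: with probability at
least `1 − 4n²·e^{−τ²/(1+τ)}`, the subsampled degree matrix is invertible and
`max_{i,j} n·|[P^k·(P − P̂)]_{ij}| ≤ 4·n^{−α/2}·d^{−2}·τ`. -/
theorem stmt17 (n k : ℕ) (hn : 2 ≤ n) (hk : 1 ≤ k) (α γ d τ : ℝ)
    (hα1 : 1 / 2 < α) (hα2 : α ≤ 1) (hγ : γ = (n : ℝ) ^ (α - 1))
    (hd0 : 0 < d) (hd1 : d ≤ 1)
    (hτ0 : 0 < τ) (hτub : τ ≤ d * (n : ℝ) ^ (α / 2) / 4)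
    (A : Matrix (Fin n) (Fin n) ℝ) (hAsymm : A.IsSymm)
    (hA01 : ∀ i j, A i j ∈ Set.Icc (0 : ℝ) 1) (hAdiag : ∀ i, A i i = 0)
    (hDlb : ∀ i, (n : ℝ) * d ≤ ∑ j, A i j) :
    ENNReal.ofReal (1 - 4 * n ^ 2 * Real.exp (-(τ ^ 2) / (1 + τ))) ≤
      edgeMeasure A γ
        {e | (∀ i, 0 < ∑ j, hatA e i j) ∧
          ∀ i j : Fin n,
            (n : ℝ) *
              |(((Matrix.of fun i' j' : Fin n => A i' j' / ∑ l, A i' l) ^ k) *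
                  ((Matrix.of fun i' j' : Fin n => A i' j' / ∑ l, A i' l) -
                    (Matrix.of fun i' j' : Fin n => hatA e i' j' / ∑ l, hatA e i' l))) i j| ≤
            4 * (n : ℝ) ^ (-α / 2) * (d ^ 2)⁻¹ * τ} := by
  have hn2 : (2 : ℝ) ≤ n := by exact_mod_cast hn
  have hN : (0 : ℝ) < n := by linarith
  rcases le_or_gt 1 (4 * (n : ℝ) ^ 2 * Real.exp (-(τ ^ 2) / (1 + τ))) with htriv | hlt
  · rw [ENNReal.ofReal_of_nonpos (by linarith)]
    exact zero_le
  have hτ3 := three_le_of_mul_exp_lt_one hn hτ0 hlt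
  have hγ0 : 0 < γ := hγ ▸ Real.rpow_pos_of_pos hN _
  have hγ1 : γ ≤ 1 := hγ ▸ Real.rpow_le_one_of_one_le_of_nonpos (by linarith) (by linarith)
  have hainv : (n : ℝ) ^ (-α / 2) = ((n : ℝ) ^ (α / 2))⁻¹ := by
    rw [← Real.rpow_neg hN.le]; ring_nf
  have haN : ((n : ℝ) ^ (α / 2)) ^ 2 = γ * n := by
    rw [hγ, ← Real.rpow_mul_natCast hN.le, ← Real.rpow_add_one hN.ne']
    push_cast
    ring_nf
  have ha : 0 < (n : ℝ) ^ (α / 2) := Real.rpow_pos_of_pos hN _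
  rw [hainv]
  generalize (n : ℝ) ^ (α / 2) = a at *
  have hp : ∀ i j, γ * A i j ∈ Set.Icc (0 : ℝ) 1 := fun i j =>
    ⟨mul_nonneg hγ0.le (hA01 i j).1, mul_le_one₀ hγ1 (hA01 i j).1 (hA01 i j).2⟩
  have hpγ : ∀ i j, γ * A i j ≤ γ := fun i j => mul_le_of_le_one_right hγ0.le (hA01 i j).2
  have hprob := isProbabilityMeasure_edgeMeasure hp
  have hNd : 0 < (n : ℝ) * d := mul_pos hN hd0
  have hDpos : ∀ i, 0 < ∑ j, A i j := fun i => hNd.trans_le (hDlb i)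
  set P : Matrix (Fin n) (Fin n) ℝ := Matrix.of fun i' j' : Fin n => A i' j' / ∑ l, A i' l with hP
  have hPst : P ∈ Matrix.rowStochastic ℝ (Fin n) := by
    refine Matrix.mem_rowStochastic_iff_sum.2 ⟨fun i j => div_nonneg (hA01 i j).1 (hDpos i).le,
      fun i => ?_⟩
    simp only [hP, Matrix.of_apply]
    rw [← Finset.sum_div, div_self (hDpos i).ne']
  have hPle : ∀ i j, P i j ≤ 1 / (n * d) := fun i j =>
    div_le_div₀ zero_le_one (hA01 i j).2 hNd (hDlb i)
  have hPk : P ^ k ∈ Matrix.rowStochastic ℝ (Fin n) := pow_mem hPst k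
  have hPk0 : ∀ i j, 0 ≤ (P ^ k) i j := fun i j => Matrix.nonneg_of_mem_rowStochastic hPk
  have hPkle : ∀ i j, (P ^ k) i j ≤ 1 / (n * d) := by
    obtain ⟨m, rfl⟩ := Nat.exists_eq_add_of_le' hk
    rw [pow_succ]
    exact Matrix.mul_apply_le_of_mem_rowStochastic (pow_mem hPst m) hPle
  let u : Option (Fin n) → Fin n → ℝ := fun o l =>
    o.elim 1 fun i => (n * d) ^ 2 * ((P ^ k) i l / ∑ m, A l m)
  have hu : ∀ o l, |u o l| ≤ 1 := by
    rintro (_ | i) l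
    · simp [u]
    · simp only [u, Option.elim]
      rw [abs_of_nonneg (mul_nonneg (sq_nonneg _) (div_nonneg (hPk0 i l) (hDpos l).le))]
      calc ((n : ℝ) * d) ^ 2 * ((P ^ k) i l / ∑ m, A l m)
          ≤ (n * d) ^ 2 * (1 / (n * d) / (n * d)) := by
            gcongr
            exacts [hPkle i l, hDlb l]
        _ = 1 := by field_simp
  let bad : Option (Fin n) × Fin n → Set ({q : Fin n × Fin n // q.1 < q.2} → Bool) :=
    fun x => {e | τ * a ≤ |∑ l, u x.1 l * (hatA e l x.2 - γ * A l x.2)|}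
  have hbad : ∀ x, (edgeMeasure A γ).real (bad x) ≤ 2 * Real.exp (-(τ ^ 2) / (1 + τ)) := by
    intro x
    have hτa : τ / a ≤ 1 / 4 := by
      rw [div_le_iff₀ ha]
      nlinarith
    refine (edgeMeasure_abs_weighted_column_ge_le hAsymm hAdiag hp hpγ (hu x.1) x.2
      (s := τ / a / 2) (by positivity) (by linarith)).trans ?_
    gcongr
    rw [← haN]
    calc a ^ 2 * (τ / a / 2) ^ 2 - τ / a / 2 * (τ * a) = -(τ ^ 2) / 4 := by
          field_simp
          ring
      _ ≤ -(τ ^ 2) / (1 + τ) := by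
          rw [neg_div, neg_div]
          gcongr
          linarith
  have hunion : (edgeMeasure A γ).real (⋃ x, bad x) ≤
      4 * n ^ 2 * Real.exp (-(τ ^ 2) / (1 + τ)) := by
    calc (edgeMeasure A γ).real (⋃ x, bad x) ≤ ∑ x, (edgeMeasure A γ).real (bad x) :=
          measureReal_iUnion_fintype_le _
      _ ≤ ∑ _x : Option (Fin n) × Fin n, 2 * Real.exp (-(τ ^ 2) / (1 + τ)) :=
          Finset.sum_le_sum fun x _ => hbad x
      _ = (2 * ((n + 1) * n)) * Real.exp (-(τ ^ 2) / (1 + τ)) := by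
          simp
          ring
      _ ≤ 4 * n ^ 2 * Real.exp (-(τ ^ 2) / (1 + τ)) := by
          gcongr ?_ * _
          nlinarith
  have hcompl : 1 - 4 * n ^ 2 * Real.exp (-(τ ^ 2) / (1 + τ)) ≤
      (edgeMeasure A γ).real (⋃ x, bad x)ᶜ := by
    rw [probReal_compl_eq_one_sub .of_discrete]
    linarith
  refine (ENNReal.ofReal_le_ofReal hcompl).trans ?_
  rw [ofReal_measureReal]
  refine measure_mono fun e he => ?_
  have hgood : ∀ o j, |∑ l, u o l * (hatA e l j - γ * A l j)| ≤ τ * a := by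
    intro o j
    by_contra! h
    exact he (Set.mem_iUnion.2 ⟨(o, j), h.le⟩)
  have hdeg : ∀ l, |∑ m, hatA e l m - γ * ∑ m, A l m| ≤ τ * a := by
    intro l
    convert hgood none l using 2
    rw [Finset.mul_sum, ← Finset.sum_sub_distrib]
    refine Finset.sum_congr rfl fun m _ => ?_
    simp [u, hatA_comm e l m, hAsymm.apply l m]
  refine ⟨fun i => ?_, fun i j => ?_⟩
  · have h1 := (abs_le.1 (hdeg i)).1
    have h2 : γ * (n * d) ≤ γ * ∑ m, A i m := mul_le_mul_of_nonneg_left (hDlb i) hγ0.le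
    have h3 : τ * a ≤ d * a / 4 * a := mul_le_mul_of_nonneg_right hτub ha.le
    have h4 : γ * (n * d) = d * a ^ 2 := by rw [haN]; ring
    have h5 : 0 < d * a ^ 2 := by positivity
    linarith
  · have hmul : (P ^ k * P) i j ≤ 1 / (n * d) :=
      Matrix.mul_apply_le_of_mem_rowStochastic hPk hPle i j
    rw [Matrix.mul_apply] at hmul ⊢
    exact abs_sum_transition_sub_le hN ha hγ0 haN hd0 hτ0 hτub hDlb (hatA_nonneg e) (hPk0 i) j
      hmul hdeg (hgood (some i) j)
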